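/- Let n ≥ 1, T ≥ 1, N₀ > 0, let μ ∈ ℂ^T, let μ̃ : ℝⁿ → ℂ^T be continuously differentiable, and let η₀ ∈ ℝⁿ. Define the assumed log-likelihood ℓ(y, η) = −T·log(π N₀) − ‖y − μ̃(η)‖²/N₀ and ε = μ − μ̃(η₀). Then for all standard basis vectors eᵢ, eⱼ of ℝⁿ, ∫ (D_η ℓ(y, ·)(η₀)(eᵢ)) · (D_η ℓ(y, ·)(η₀)(eⱼ)) dP_μ(y) = (2/N₀)·[ (2/N₀)·Re(⟨∂ᵢμ̃(η₀), ε⟩)·Re(⟨∂ⱼμ̃(η₀), ε⟩) + Re(⟨∂ᵢμ̃(η₀), ∂ⱼμ̃(η₀)⟩) ]. -/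

import Mathlib

open MeasureTheory ProbabilityTheory
open scoped ComplexConjugate

/-- The complex Gaussian measure on `ℂ` with mean `m` and variance `N₀`: the real and imaginary
parts are independent real Gaussians with means `m.re`, `m.im` and common variance `N₀/2`. -/
noncomputable def complexGaussian (m : ℂ) (N0 : ℝ) : Measure ℂ :=
  ((gaussianReal m.re (N0 / 2).toNNReal).prod
    (gaussianReal m.im (N0 / 2).toNNReal)).map Complex.measurableEquivRealProd.symm

/-- The complex Gaussian product measure `P_μ` on `ℂ^T`. -/
noncomputable def gaussianPi (T : ℕ) (μ : Fin T → ℂ) (N0 : ℝ) : Measure (Fin T → ℂ) :=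
  Measure.pi fun t => complexGaussian (μ t) N0

/-- The Hermitian inner product `⟨a,b⟩ = ∑ t, conj (a t) * b t` on `ℂ^T`. -/
noncomputable def hip {T : ℕ} (a b : Fin T → ℂ) : ℂ := ∑ t, conj (a t) * b t

/-- The assumed log-likelihood `ℓ(y, η) = −T·log(π N₀) − ‖y − μ̃(η)‖²/N₀`. -/
noncomputable def loglik {n T : ℕ} (N0 : ℝ) (μtil : (Fin n → ℝ) → Fin T → ℂ)
    (y : Fin T → ℂ) (η : Fin n → ℝ) : ℝ :=
  -(T : ℝ) * Real.log (Real.pi * N0) - (∑ t, Complex.normSq (y t - μtil η t)) / N0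

instance (m : ℂ) (N0 : ℝ) : IsProbabilityMeasure (complexGaussian m N0) := by
  unfold complexGaussian
  exact Measure.isProbabilityMeasure_map (by fun_prop)

instance (T : ℕ) (μ : Fin T → ℂ) (N0 : ℝ) : IsProbabilityMeasure (gaussianPi T μ N0) := by
  unfold gaussianPi
  infer_instance

/-- Derivative of the log-likelihood. -/
lemma fderiv_loglik {n T : ℕ} (N0 : ℝ) 
    (μtil : (Fin n → ℝ) → Fin T → ℂ) (hμtil : ContDiff ℝ 1 μtil)
    (η₀ v : Fin n → ℝ) (y : Fin T → ℂ) :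
    fderiv ℝ (loglik N0 μtil y) η₀ v =
      (2 / N0) * ∑ t, ((fderiv ℝ μtil η₀ v t).re * ((y t).re - (μtil η₀ t).re) +
        (fderiv ℝ μtil η₀ v t).im * ((y t).im - (μtil η₀ t).im)) := by
  have hd : HasFDerivAt μtil (fderiv ℝ μtil η₀) η₀ :=
    (hμtil.differentiable (by norm_num) η₀).hasFDerivAt
  have hdt := fun t => (hasFDerivAt_pi'.1 hd) t
  have hre := fun t => (Complex.reCLM.hasFDerivAt.comp η₀ (hdt t)).const_sub (y t).re
  have him := fun t => (Complex.imCLM.hasFDerivAt.comp η₀ (hdt t)).const_sub (y t).im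
  have hs := HasFDerivAt.fun_sum (u := Finset.univ)
    (fun t _ => ((hre t).mul (hre t)).add ((him t).mul (him t)))
  have h := (hs.mul_const (N0⁻¹)).const_sub (-(T : ℝ) * Real.log (Real.pi * N0))
  have h2 : HasFDerivAt (loglik N0 μtil y) _ η₀ := h
  rw [h2.fderiv]
  simp [Finset.mul_sum, ← Finset.sum_neg_distrib]
  refine Finset.sum_congr rfl fun t _ => ?_
  ring

lemma cg_memLp (m : ℂ) (N0 : ℝ) :
    MemLp (fun z : ℂ => z.re) 2 (complexGaussian m N0) ∧
    MemLp (fun z : ℂ => z.im) 2 (complexGaussian m N0) := by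
  unfold complexGaussian
  have hm : AEMeasurable (Complex.measurableEquivRealProd.symm)
    ((gaussianReal m.re (N0 / 2).toNNReal).prod
    (gaussianReal m.im (N0 / 2).toNNReal)) := by fun_prop
  constructor
  · rw [memLp_map_measure_iff (by fun_prop) hm]
    exact (memLp_id_gaussianReal' 2 (by norm_num)).comp_fst _
  · rw [memLp_map_measure_iff (by fun_prop) hm]
    exact (memLp_id_gaussianReal' 2 (by norm_num)).comp_snd _

lemma cg_lin (m a c : ℂ) (N0 : ℝ) :
    MemLp (fun z : ℂ => a.re * (z.re - c.re) + a.im * (z.im - c.im)) 2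
      (complexGaussian m N0) :=
  (((cg_memLp m N0).1.sub (memLp_const c.re)).const_mul a.re).add
    (((cg_memLp m N0).2.sub (memLp_const c.im)).const_mul a.im)

lemma cg_mean (m : ℂ) (N0 : ℝ) :
    ∫ z, z.re ∂(complexGaussian m N0) = m.re ∧ ∫ z, z.im ∂(complexGaussian m N0) = m.im := by
  unfold complexGaussian
  constructor
  · rw [integral_map_equiv]
    change ∫ x : ℝ × ℝ, id x.1 ∂_ = _
    rw [integral_fun_fst]; simp
  · rw [integral_map_equiv]
    change ∫ x : ℝ × ℝ, id x.2 ∂_ = _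
    rw [integral_fun_snd]; simp

lemma cg_mean_lin (m a c : ℂ) (N0 : ℝ) :
    ∫ z, (a.re * (z.re - c.re) + a.im * (z.im - c.im)) ∂(complexGaussian m N0)
      = a.re * (m.re - c.re) + a.im * (m.im - c.im) := by
  have h1 := (cg_memLp m N0).1.integrable (by norm_num)
  have h2 := (cg_memLp m N0).2.integrable (by norm_num)
  have h1' : Integrable (fun z : ℂ => a.re * (z.re - c.re)) (complexGaussian m N0) :=
    (h1.sub (integrable_const _)).const_mul _
  have h2' : Integrable (fun z : ℂ => a.im * (z.im - c.im)) (complexGaussian m N0) :=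
    (h2.sub (integrable_const _)).const_mul _
  rw [integral_add h1' h2', integral_const_mul, integral_const_mul,
    integral_sub h1 (integrable_const _), integral_sub h2 (integrable_const _),
    (cg_mean m N0).1, (cg_mean m N0).2]
  simp

lemma cg_cov (m : ℂ) (N0 : ℝ) (hN0 : 0 < N0) :
    cov[fun z : ℂ => z.re, fun z : ℂ => z.re; complexGaussian m N0] = N0 / 2 ∧
    cov[fun z : ℂ => z.im, fun z : ℂ => z.im; complexGaussian m N0] = N0 / 2 ∧
    cov[fun z : ℂ => z.re, fun z : ℂ => z.im; complexGaussian m N0] = 0 := by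
  unfold complexGaussian
  have hm : AEMeasurable (Complex.measurableEquivRealProd.symm)
    ((gaussianReal m.re (N0 / 2).toNNReal).prod
    (gaussianReal m.im (N0 / 2).toNNReal)) := by fun_prop
  refine ⟨?_, ?_, ?_⟩
  · rw [covariance_self (by fun_prop), variance_map (by fun_prop) hm]
    change Var[fun x : ℝ × ℝ => id x.1; _] = _
    rw [measurePreserving_fst.variance_fun_comp (by fun_prop), variance_id_gaussianReal]
    exact Real.coe_toNNReal _ (by positivity)
  · rw [covariance_self (by fun_prop), variance_map (by fun_prop) hm]
    change Var[fun x : ℝ × ℝ => id x.2; _] = _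
    rw [measurePreserving_snd.variance_fun_comp (by fun_prop), variance_id_gaussianReal]
    exact Real.coe_toNNReal _ (by positivity)
  · rw [covariance_map (by fun_prop) (by fun_prop) hm]
    exact covariance_fst_snd_prod (X := id) (Y := id)
      (memLp_id_gaussianReal' 2 (by norm_num)) (memLp_id_gaussianReal' 2 (by norm_num))

lemma cg_cov_lin (m a b c : ℂ) (N0 : ℝ) (hN0 : 0 < N0) :
    cov[fun z : ℂ => a.re * (z.re - c.re) + a.im * (z.im - c.im),
      fun z : ℂ => b.re * (z.re - c.re) + b.im * (z.im - c.im); complexGaussian m N0]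
      = N0 / 2 * (a.re * b.re + a.im * b.im) := by
  obtain ⟨hR, hI⟩ := cg_memLp m N0
  obtain ⟨h1, h2, h3⟩ := cg_cov m N0 hN0
  have hR' : MemLp (fun z : ℂ => z.re - c.re) 2 (complexGaussian m N0) := hR.sub (memLp_const _)
  have hI' : MemLp (fun z : ℂ => z.im - c.im) 2 (complexGaussian m N0) := hI.sub (memLp_const _)
  have iR := hR.integrable (by norm_num)
  have iI := hI.integrable (by norm_num)
  have e1 := covariance_add_left (hR'.const_mul a.re) (hI'.const_mul a.im) (cg_lin m b c N0)
  have e2 := covariance_add_right hR' (hR'.const_mul b.re) (hI'.const_mul b.im)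
  have e3 := covariance_add_right hI' (hR'.const_mul b.re) (hI'.const_mul b.im)
  rw [covariance_const_mul_right, covariance_const_mul_right] at e2 e3
  rw [covariance_const_mul_left, covariance_const_mul_left] at e1
  refine e1.trans ?_
  refine (congrArg₂ (· + ·) (congrArg _ e2) (congrArg _ e3)).trans ?_
  rw [covariance_comm (fun z : ℂ => z.im - c.im) (fun z : ℂ => z.re - c.re)]
  simp only [covariance_sub_const_left iR, covariance_sub_const_left iI,
    covariance_sub_const_right iR, covariance_sub_const_right iI, h1, h2, h3]
  ring

/-- The real-linear functional appearing in the score. -/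
noncomputable def lin {T : ℕ} (a c : Fin T → ℂ) (t : Fin T) (z : ℂ) : ℝ :=
  (a t).re * (z.re - (c t).re) + (a t).im * (z.im - (c t).im)

lemma lin_meas {T : ℕ} (a c : Fin T → ℂ) (t : Fin T) : Measurable (lin a c t) := by
  unfold lin; fun_prop

lemma mp_eval (T : ℕ) (μ : Fin T → ℂ) (N0 : ℝ) (t : Fin T) :
    MeasurePreserving (Function.eval t) (gaussianPi T μ N0) (complexGaussian (μ t) N0) :=
  measurePreserving_eval _ t

lemma key {T : ℕ} (a b c μ : Fin T → ℂ) (N0 : ℝ) (hN0 : 0 < N0) :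
    ∫ y, (∑ t, lin a c t (y t)) * (∑ t, lin b c t (y t)) ∂(gaussianPi T μ N0)
      = (∑ t, lin a c t (μ t)) * (∑ t, lin b c t (μ t))
        + N0 / 2 * ∑ t, ((a t).re * (b t).re + (a t).im * (b t).im) := by
  have hL : ∀ a : Fin T → ℂ, ∀ t,
      MemLp (fun y : Fin T → ℂ => lin a c t (y t)) 2 (gaussianPi T μ N0) := fun a t =>
    (cg_lin (μ t) (a t) (c t) N0).comp_measurePreserving (mp_eval T μ N0 t)
  have hE : ∀ a : Fin T → ℂ, ∫ y, ∑ t, lin a c t (y t) ∂(gaussianPi T μ N0)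
      = ∑ t, lin a c t (μ t) := by
    intro a
    rw [integral_finsetSum _ fun t _ => (hL a t).integrable (by norm_num)]
    refine Finset.sum_congr rfl fun t _ => ?_
    have := integral_map (μ := gaussianPi T μ N0) (mp_eval T μ N0 t).measurable.aemeasurable
      (lin_meas a c t).aestronglyMeasurable
    rw [(mp_eval T μ N0 t).map_eq] at this
    exact this.symm.trans (cg_mean_lin _ _ _ _)
  have hS : ∀ a : Fin T → ℂ,
      MemLp (fun y : Fin T → ℂ => ∑ t, lin a c t (y t)) 2 (gaussianPi T μ N0) := fun a =>
    memLp_finsetSum _ fun t _ => hL a t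
  have hc := covariance_eq_sub (hS a) (hS b)
  rw [hE, hE, covariance_fun_sum_fun_sum (hL a) (hL b)] at hc
  have hcov : ∀ s t, cov[fun y : Fin T → ℂ => lin a c s (y s), fun y => lin b c t (y t);
      gaussianPi T μ N0] =
      if s = t then N0 / 2 * ((a t).re * (b t).re + (a t).im * (b t).im) else 0 := by
    intro s t
    split_ifs with h
    · subst h
      rw [← cg_cov_lin (μ s) (a s) (b s) (c s) N0 hN0, ← (mp_eval T μ N0 s).map_eq,
        covariance_map (by fun_prop) (by fun_prop) (mp_eval T μ N0 s).measurable.aemeasurable]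
      rfl
    · have hi : iIndepFun (fun (t : Fin T) (y : Fin T → ℂ) => y t) (gaussianPi T μ N0) :=
        iIndepFun_pi (X := fun _ => id) (fun t => by fun_prop)
      exact ((hi.indepFun h).comp (lin_meas a c s) (lin_meas b c t)).covariance_eq_zero
        (hL a s) (hL b t)
  simp only [hcov, Finset.sum_ite_eq, Finset.mem_univ, if_true] at hc
  rw [Finset.mul_sum Finset.univ _ (N0 / 2)]
  have hc' := eq_add_of_sub_eq hc.symm
  rw [add_comm]
  exact hc'

lemma hip_re {T : ℕ} (a b : Fin T → ℂ) :
    (hip a b).re = ∑ t, ((a t).re * (b t).re + (a t).im * (b t).im) := by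
  simp [hip, Complex.mul_re]

theorem stmt9 (n T : ℕ) (hn : 1 ≤ n) (hT : 1 ≤ T) (N0 : ℝ) (hN0 : 0 < N0)
    (μ : Fin T → ℂ) (μtil : (Fin n → ℝ) → Fin T → ℂ) (hμtil : ContDiff ℝ 1 μtil)
    (η₀ : Fin n → ℝ) (i j : Fin n) :
    ∫ y, (fderiv ℝ (loglik N0 μtil y) η₀ (Pi.single i 1)) *
          (fderiv ℝ (loglik N0 μtil y) η₀ (Pi.single j 1)) ∂(gaussianPi T μ N0)
      = (2 / N0) *
          ((2 / N0) * (hip (fderiv ℝ μtil η₀ (Pi.single i 1)) (fun t => μ t - μtil η₀ t)).re *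
              (hip (fderiv ℝ μtil η₀ (Pi.single j 1)) (fun t => μ t - μtil η₀ t)).re +
            (hip (fderiv ℝ μtil η₀ (Pi.single i 1)) (fderiv ℝ μtil η₀ (Pi.single j 1))).re) := by
  simp only [fderiv_loglik N0 μtil hμtil]
  have hk := key (fderiv ℝ μtil η₀ (Pi.single i 1)) (fderiv ℝ μtil η₀ (Pi.single j 1))
    (μtil η₀) μ N0 hN0
  simp only [lin] at hk
  simp only [mul_mul_mul_comm, integral_const_mul, hk, hip_re, Complex.sub_re, Complex.sub_im]
  field_simp
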